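/- Let R be a ring and M an R-R-bimodule. The trivial extension T(R, M), consisting of pairs (r, m) with componentwise addition and multiplication (r,m)(s,n) = (rs, rn + ms), is weakly strongly 2-nil-clean if and only if R is weakly strongly 2-nil-clean. -/

import Mathlib

/-- A ring is weakly strongly 2-nil-clean if every element is `±e ± f + n` with
`e, f` idempotents and `n` nilpotent, all commuting with each other. -/
def IsWeaklyStrongly2NilClean (R : Type*) [Ring R] : Prop :=
  ∀ a : R, ∃ e f n : R, IsIdempotentElem e ∧ IsIdempotentElem f ∧ IsNilpotent n ∧
    Commute e f ∧ Commute e n ∧ Commute f n ∧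
    (a = e + f + n ∨ a = e - f + n ∨ a = -e + f + n ∨ a = -e - f + n)

/-- A ring is strongly 2-nil-clean if every element is `e + f + n` with
`e, f` idempotents and `n` nilpotent, all commuting with each other. -/
def IsStrongly2NilClean (R : Type*) [Ring R] : Prop :=
  ∀ a : R, ∃ e f n : R, IsIdempotentElem e ∧ IsIdempotentElem f ∧ IsNilpotent n ∧
    Commute e f ∧ Commute e n ∧ Commute f n ∧ a = e + f + n

/-- An element is strongly 2-nil-clean if it is `e + f + n` with `e, f` idempotents and
`n` nilpotent, all commuting with each other. -/
def IsStrongly2NilCleanElem {R : Type*} [Ring R] (a : R) : Prop :=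
  ∃ e f n : R, IsIdempotentElem e ∧ IsIdempotentElem f ∧ IsNilpotent n ∧
    Commute e f ∧ Commute e n ∧ Commute f n ∧ a = e + f + n

theorem isWeaklyStrongly2NilClean_iff_elem {R : Type*} [Ring R] :
    IsWeaklyStrongly2NilClean R ↔ ∀ a : R, IsStrongly2NilCleanElem a ∨
      IsStrongly2NilCleanElem (a + 1) ∨ IsStrongly2NilCleanElem (-a) := by
  refine forall_congr' fun a ↦ ⟨?_, ?_⟩
  · rintro ⟨e, f, n, he, hf, hn, hef, hen, hfn, rfl | rfl | rfl | rfl⟩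
    · exact .inl ⟨e, f, n, he, hf, hn, hef, hen, hfn, rfl⟩
    · exact .inr <| .inl ⟨e, 1 - f, n, he, hf.one_sub, hn, (Commute.one_right e).sub_right hef, hen,
        (Commute.one_left n).sub_left hfn, by abel⟩
    · exact .inr <| .inl ⟨1 - e, f, n, he.one_sub, hf, hn, (Commute.one_left f).sub_left hef,
        (Commute.one_left n).sub_left hen, hfn, by abel⟩
    · exact .inr <| .inr ⟨e, f, -n, he, hf, hn.neg, hef, hen.neg_right, hfn.neg_right, by abel⟩
  · rintro (⟨e, f, n, he, hf, hn, hef, hen, hfn, h⟩ | ⟨e, f, n, he, hf, hn, hef, hen, hfn, h⟩ |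
      ⟨e, f, n, he, hf, hn, hef, hen, hfn, h⟩)
    · exact ⟨e, f, n, he, hf, hn, hef, hen, hfn, .inl h⟩
    · refine ⟨e, 1 - f, n, he, hf.one_sub, hn, (Commute.one_right e).sub_right hef, hen,
        (Commute.one_left n).sub_left hfn, .inr <| .inl ?_⟩
      rw [eq_sub_of_add_eq h]
      abel
    · refine ⟨e, f, -n, he, hf, hn.neg, hef, hen.neg_right, hfn.neg_right,
        .inr <| .inr <| .inr ?_⟩
      rw [← neg_neg a, h]
      abel

theorem IsStrongly2NilCleanElem.isNilpotent {R : Type*} [Ring R] {a : R}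
    (h : IsStrongly2NilCleanElem a) : IsNilpotent (a * (a - 1) * (a - 2)) := by
  obtain ⟨e, f, n, he, hf, hn, hef, hen, hfn, rfl⟩ := h
  have hs : (e + f) * (e + f - 1) * (e + f - 2) = 0 := by
    have hmul : (e + f) * (e + f - 1) = 2 • (e * f) := by
      simp only [mul_sub, mul_add, add_mul, he.eq, hf.eq, ← hef.eq, mul_one]
      abel
    have hefe : e * f * e = e * f := by rw [hef.eq, mul_assoc, he.eq]
    rw [hmul, smul_mul_assoc, mul_sub, mul_add, hefe, mul_assoc, hf.eq, mul_two, sub_self,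
      smul_zero]
  have hsn : Commute n (e + f) := (hen.add_left hfn).symm
  generalize e + f = s at hs hsn
  have key : (s + n) * (s + n - 1) * (s + n - 2) = s * (s - 1) * (s - 2) +
      n * (3 • s ^ 2 + 3 • (s * n) + n ^ 2 - 6 • s - 3 • n + 2 • 1) := by
    rw [← one_add_one_eq_two]
    simp only [pow_two, mul_add, add_mul, mul_sub, sub_mul, mul_assoc, mul_one,
      mul_smul_comm, hsn.eq, hsn.left_comm]
    abel
  rw [key, hs, zero_add]
  have hcomm : Commute n (3 • s ^ 2 + 3 • (s * n) + n ^ 2 - 6 • s - 3 • n + 2 • 1) :=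
    (hsn.pow_right 2).smul_right 3
      |>.add_right ((hsn.mul_right (.refl n)).smul_right 3)
      |>.add_right ((Commute.refl n).pow_right 2)
      |>.sub_right (hsn.smul_right 6)
      |>.sub_right ((Commute.refl n).smul_right 3)
      |>.add_right ((Commute.one_right n).smul_right 2)
  exact hcomm.isNilpotent_mul_right hn

theorem exists_isIdempotentElem_isNilpotent_sub {A : Type*} [CommRing A] {a : A}
    (h : IsNilpotent (a ^ 2 - a)) : ∃ e : A, IsIdempotentElem e ∧ IsNilpotent (a - e) := by
  let π := Ideal.Quotient.mk (nilradical A)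
  have hker (x : A) : x ∈ RingHom.ker π ↔ IsNilpotent x := by
    rw [Ideal.mk_ker, mem_nilradical]
  have hidem : IsIdempotentElem (π a) := by
    rw [← hker, RingHom.mem_ker, map_sub, map_pow, sub_eq_zero, sq] at h
    exact h
  obtain ⟨e, he, hea⟩ := exists_isIdempotentElem_eq_of_ker_isNilpotent π
    (fun x hx ↦ (hker x).1 hx) (π a) ⟨a, rfl⟩ hidem
  refine ⟨e, he, (hker _).1 ?_⟩
  rw [RingHom.mem_ker, map_sub, hea, sub_self]

theorem isStrongly2NilCleanElem_of_commRing {A : Type*} [CommRing A] {a : A}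
    (h30 : IsNilpotent (30 : A)) (h : IsNilpotent (a * (a - 1) * (a - 2))) :
    IsStrongly2NilCleanElem a := by
  -- Modulo nilpotents, `8 * a * (a - 1)` is `a * (a - 1) / 2` where `2` is invertible,
  -- and `0` where `2 = 0`.
  have h15 : IsNilpotent (15 * a * (a - 1)) := by
    refine IsNilpotent.of_pow (m := 2) ?_
    rw [← mem_nilradical] at h h30 ⊢
    convert add_mem (Ideal.mul_mem_left _ (225 * (a + 1)) h)
      (Ideal.mul_mem_left _ (15 * a * (a - 1)) h30) using 1
    ring
  obtain ⟨f, hf, hf'⟩ := exists_isIdempotentElem_isNilpotent_sub (a := 8 * a * (a - 1)) <| by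
    rw [← mem_nilradical] at h h15 ⊢
    convert add_mem (Ideal.mul_mem_left _ (64 * (a + 1)) h) (Ideal.mul_mem_left _ 8 h15) using 1
    ring
  obtain ⟨e, he, he'⟩ := exists_isIdempotentElem_isNilpotent_sub (a := a - 8 * a * (a - 1)) <| by
    rw [← mem_nilradical] at h h15 ⊢
    convert add_mem (Ideal.mul_mem_left _ (64 * (a + 1) - 16) h)
      (Ideal.mul_mem_left _ 7 h15) using 1
    ring
  refine ⟨e, f, a - e - f, he, hf, ?_, .all _ _, .all _ _, .all _ _, by ring⟩
  convert (Commute.all _ _).isNilpotent_add he' hf' using 1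
  ring

theorem IsStrongly2NilCleanElem.map {A R : Type*} [Ring A] [Ring R] (φ : A →+* R) {a : A}
    (h : IsStrongly2NilCleanElem a) : IsStrongly2NilCleanElem (φ a) := by
  obtain ⟨e, f, n, he, hf, hn, hef, hen, hfn, rfl⟩ := h
  exact ⟨φ e, φ f, φ n, he.map φ, hf.map φ, hn.map φ, hef.map φ, hen.map φ, hfn.map φ, by simp⟩

theorem isStrongly2NilCleanElem_of_isNilpotent {R : Type*} [Ring R] {a : R}
    (h30 : IsNilpotent (30 : R)) (h : IsNilpotent (a * (a - 1) * (a - 2))) :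
    IsStrongly2NilCleanElem a := by
  let ψ : Polynomial ℤ →+* R := (Polynomial.aeval a).toRingHom
  let φ := RingHom.kerLift ψ
  have hφ : Function.Injective φ := RingHom.kerLift_injective ψ
  let b := Ideal.Quotient.mk (RingHom.ker ψ) Polynomial.X
  have hb : φ b = a :=
    (RingHom.kerLift_mk ψ _).trans (Polynomial.aeval_X a)
  rw [← hb]
  refine (isStrongly2NilCleanElem_of_commRing ?_ ?_).map φ
  · rw [← IsNilpotent.map_iff hφ]
    simpa only [map_ofNat] using h30
  · rw [← IsNilpotent.map_iff hφ]
    simpa only [map_mul, map_sub, map_one, map_ofNat, hb] using h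

theorem isWeaklyStrongly2NilClean_iff_isNilpotent {R : Type*} [Ring R] :
    IsWeaklyStrongly2NilClean R ↔ ∀ a : R, IsNilpotent (a * (a - 1) * (a - 2)) ∨
      IsNilpotent ((a + 1) * (a + 1 - 1) * (a + 1 - 2)) ∨
      IsNilpotent (-a * (-a - 1) * (-a - 2)) := by
  rw [isWeaklyStrongly2NilClean_iff_elem]
  refine ⟨fun h a ↦ (h a).imp (·.isNilpotent) (Or.imp (·.isNilpotent) (·.isNilpotent)),
    fun h a ↦ ?_⟩
  have h30 : IsNilpotent (30 : R) := by
    have key (z : ℤ) (k : ℕ) (hz : z ∣ 30 ^ k) (hn : IsNilpotent (z : R)) :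
        IsNilpotent (30 : R) := by
      obtain ⟨w, hw⟩ := hz
      refine IsNilpotent.of_pow (m := k) ?_
      have : (30 : R) ^ k = z * w := by exact_mod_cast congrArg (Int.cast : ℤ → R) hw
      rw [this]
      exact (Int.cast_commute z (w : R)).isNilpotent_mul_right hn
    rcases h 3 with h | h | h
    · exact key 6 1 (by norm_num) (by norm_num at h ⊢; exact h)
    · exact key 24 3 (by norm_num) (by norm_num at h ⊢; exact h)
    · exact key (-60) 2 (by norm_num) (by norm_num at h ⊢; exact h)
  exact (h a).imp (isStrongly2NilCleanElem_of_isNilpotent h30)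
    (Or.imp (isStrongly2NilCleanElem_of_isNilpotent h30)
      (isStrongly2NilCleanElem_of_isNilpotent h30))

theorem trivSqZeroExt_wsnc_iff {R M : Type*} [Ring R] [AddCommGroup M]
    [Module R M] [Module Rᵐᵒᵖ M] [SMulCommClass R Rᵐᵒᵖ M] :
    IsWeaklyStrongly2NilClean (TrivSqZeroExt R M) ↔ IsWeaklyStrongly2NilClean R := by
  simp only [isWeaklyStrongly2NilClean_iff_isNilpotent,
    TrivSqZeroExt.isNilpotent_iff_isNilpotent_fst, TrivSqZeroExt.fst_mul, TrivSqZeroExt.fst_sub,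
    TrivSqZeroExt.fst_add, TrivSqZeroExt.fst_neg, TrivSqZeroExt.fst_one,
    ← one_add_one_eq_two]
  rw [(TrivSqZeroExt.fst_surjective (R := R) (M := M)).forall]
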